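/- Let k be a field, A a smooth k-algebra, and j ≥ 1. The assignment θ̄ ⊗ δ ↦ class of θ·p₁^*(δ) defines an isomorphism of A-modules I/I² ⊗_A Ω^j_A ≅ (I·Ω^j_{A⊗A} + (J·J)^j)/(J·J)^j, i.e. onto the image of I·Ω^j_{A⊗A} in Ω^j_{A⊗A}/(J·J)^j. -/

import Mathlib

set_option maxHeartbeats 1000000
set_option synthInstance.maxHeartbeats 400000

open TensorProduct

noncomputable section

variable (k : Type) [Field k]

/-- The element `d s` of the exterior algebra `⋀_S Ω¹_{S/k}` of Kähler differentials,
i.e. the universal derivation followed by the degree-one inclusion. -/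
def dE (S : Type) [CommRing S] [Algebra k S] (s : S) :
    ExteriorAlgebra S (KaehlerDifferential k S) :=
  ExteriorAlgebra.ι S (KaehlerDifferential.D k S s)

/-- `Ω^j_{S/k}`, realized as the degree-`j` component of the exterior algebra of
`Ω¹_{S/k}`, i.e. the `j`-th power of the image of `Ω¹` in the exterior algebra. -/
def OmegaPow (S : Type) [CommRing S] [Algebra k S] (j : ℕ) :
    Submodule S (ExteriorAlgebra S (KaehlerDifferential k S)) :=
  (LinearMap.range (ExteriorAlgebra.ι S :
    KaehlerDifferential k S →ₗ[S] ExteriorAlgebra S (KaehlerDifferential k S))) ^ j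

/-- `J^j`, the degree `j` part of the differential graded ideal of `Ω^•_{S/k}` generated
by an ideal `I ⊆ S`:  `J^0 = I` (inside `Ω^0 = S`), and
`J^j = I·Ω^j + dI ∧ Ω^{j-1}` for `j ≥ 1`. -/
def Jdeg (S : Type) [CommRing S] [Algebra k S] (I : Ideal S) :
    ℕ → Submodule S (ExteriorAlgebra S (KaehlerDifferential k S))
  | 0 => I • OmegaPow k S 0
  | j + 1 =>
      I • OmegaPow k S (j + 1) ⊔
        Submodule.span S
          {x | ∃ θ ∈ I, ∃ ε ∈ OmegaPow k S j, x = dE k S θ * ε}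

/-- `(J·J)^j = Σ_{a+b=j} J^a ∧ J^b`, the degree `j` part of the square of the differential
graded ideal generated by `I`. -/
def JJdeg (S : Type) [CommRing S] [Algebra k S] (I : Ideal S) (j : ℕ) :
    Submodule S (ExteriorAlgebra S (KaehlerDifferential k S)) :=
  ⨆ p : {p : ℕ × ℕ // p.1 + p.2 = j},
    Submodule.span S
      {x | ∃ y ∈ Jdeg k S I p.1.1, ∃ z ∈ Jdeg k S I p.1.2, x = y * z}

/-- `P` is the map `Ω^•_{S/k} → Ω^•_{T/k}` of exterior algebras of differential forms
induced by a ring homomorphism `φ : S → T` (of `k`-algebras): it is a ring homomorphism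
satisfying `P(s·1) = φ(s)·1` on scalars and `P(ds) = d(φ s)` on exact one-forms.  These
two conditions determine `P` uniquely, since the exterior algebra is generated as a ring
by the scalars and the exact one-forms. -/
def IsPullback (S T : Type) [CommRing S] [CommRing T] [Algebra k S] [Algebra k T]
    (φ : S →+* T)
    (P : ExteriorAlgebra S (KaehlerDifferential k S) →+*
      ExteriorAlgebra T (KaehlerDifferential k T)) : Prop :=
  (∀ s : S, P (algebraMap S (ExteriorAlgebra S (KaehlerDifferential k S)) s) =
    algebraMap T (ExteriorAlgebra T (KaehlerDifferential k T)) (φ s)) ∧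
  (∀ s : S, P (dE k S s) = dE k T (φ s))

section Retraction

variable {k}
variable {A B : Type} [CommRing A] [CommRing B] [Algebra k A] [Algebra k B] [Algebra A B]

/-- In `S' ⊗ ⋀ M`, the elements coming from `S' ⊗ M` anticommute. -/
theorem baseChange_ι_mul_add_swap {M S' : Type} [AddCommGroup M] [Module A M] [CommRing S']
    [Algebra A S'] (m n : S' ⊗[A] M) :
    (ExteriorAlgebra.ι A).baseChange S' m * (ExteriorAlgebra.ι A).baseChange S' n +
      (ExteriorAlgebra.ι A).baseChange S' n * (ExteriorAlgebra.ι A).baseChange S' m =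
      (0 : S' ⊗[A] ExteriorAlgebra A M) := by
  induction m with
  | zero => simp
  | add x y hx hy =>
    rw [map_add, add_mul, mul_add, add_add_add_comm, hx, hy, add_zero]
  | tmul b x =>
    induction n with
    | zero => simp
    | add y z hy hz =>
      rw [map_add, add_mul, mul_add, add_add_add_comm, hy, hz, add_zero]
    | tmul c y =>
      simp only [LinearMap.baseChange_tmul, Algebra.TensorProduct.tmul_mul_tmul]
      rw [mul_comm c b, ← TensorProduct.tmul_add, ExteriorAlgebra.ι_add_mul_swap,
        TensorProduct.tmul_zero]

/-- In `S' ⊗ ⋀ M`, the elements coming from `S' ⊗ M` square to zero. -/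
theorem baseChange_ι_mul_self {M S' : Type} [AddCommGroup M] [Module A M] [CommRing S']
    [Algebra A S'] (m : S' ⊗[A] M) :
    (ExteriorAlgebra.ι A).baseChange S' m * (ExteriorAlgebra.ι A).baseChange S' m =
      (0 : S' ⊗[A] ExteriorAlgebra A M) := by
  induction m with
  | zero => simp
  | tmul b x => simp [Algebra.TensorProduct.tmul_mul_tmul]
  | add x y hx hy =>
    rw [map_add, add_mul, mul_add, mul_add, hx, hy, zero_add, add_zero,
      baseChange_ι_mul_add_swap]

/-- For a retraction `μ` of `A → B` with kernel in `I`, the scalar actions of `b` and of `μ b`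
agree modulo `I`. -/
theorem smul_tmul_sub_mem {M S' : Type} [AddCommGroup M] [Module A M] [CommRing S']
    [Algebra A S'] [Algebra B S'] [IsScalarTower A B S'] (μ : B →ₐ[A] A) (I : Ideal B)
    (hI : ∀ b, μ b = 0 → b ∈ I) (b : B) (m : M) :
    b • ((1 : S') ⊗ₜ[A] m) - (1 : S') ⊗ₜ[A] (μ b • m) ∈
      I • (⊤ : Submodule B (S' ⊗[A] M)) := by
  have h : b • ((1 : S') ⊗ₜ[A] m) - (1 : S') ⊗ₜ[A] (μ b • m) =
      (b - algebraMap A B (μ b)) • ((1 : S') ⊗ₜ[A] m) := by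
    rw [TensorProduct.smul_tmul', TensorProduct.smul_tmul', sub_smul, algebraMap_smul,
      TensorProduct.sub_tmul, TensorProduct.smul_tmul (μ b)]
  rw [h]
  exact Submodule.smul_mem_smul (hI _ (by simp)) trivial

/-- The derivation `b ↦ 1 ⊗ d (μ b)` with values in `(S' ⊗ Ω_A) / I`. -/
def derivationModIdeal {S' : Type} [CommRing S'] [Algebra k S']
    [Algebra A S'] [Algebra B S'] [IsScalarTower A B S'] [IsScalarTower k A S']
    [IsScalarTower k B S'] [IsScalarTower k A B]
    (μ : B →ₐ[A] A) (I : Ideal B) (hI : ∀ b, μ b = 0 → b ∈ I) :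
    Derivation k B ((S' ⊗[A] Ω[A⁄k]) ⧸ (I • (⊤ : Submodule B (S' ⊗[A] Ω[A⁄k])))) :=
  Derivation.mk'
    (((I • (⊤ : Submodule B (S' ⊗[A] Ω[A⁄k]))).mkQ.restrictScalars k) ∘ₗ
      ((TensorProduct.mk A S' Ω[A⁄k] 1).restrictScalars k) ∘ₗ
      (KaehlerDifferential.D k A).toLinearMap ∘ₗ (μ.restrictScalars k).toLinearMap) (by
    intro a b
    let N := I • (⊤ : Submodule B (S' ⊗[A] Ω[A⁄k]))
    let D := KaehlerDifferential.D k A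
    change N.mkQ ((1 : S') ⊗ₜ[A] D (μ (a * b))) =
      a • N.mkQ ((1 : S') ⊗ₜ[A] D (μ b)) + b • N.mkQ ((1 : S') ⊗ₜ[A] D (μ a))
    have h (x : B) (m : Ω[A⁄k]) :
        N.mkQ ((1 : S') ⊗ₜ[A] (μ x • m)) = x • N.mkQ ((1 : S') ⊗ₜ[A] m) :=
      ((Submodule.Quotient.eq N).2 (smul_tmul_sub_mem μ I hI x m)).symm
    rw [map_mul μ, Derivation.leibniz, TensorProduct.tmul_add, map_add N.mkQ, h, h])

theorem derivationModIdeal_apply {S' : Type} [CommRing S'] [Algebra k S']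
    [Algebra A S'] [Algebra B S'] [IsScalarTower A B S'] [IsScalarTower k A S']
    [IsScalarTower k B S'] [IsScalarTower k A B]
    (μ : B →ₐ[A] A) (I : Ideal B) (hI : ∀ b, μ b = 0 → b ∈ I) (b : B) :
    derivationModIdeal (k := k) (S' := S') μ I hI b =
      Submodule.Quotient.mk ((1 : S') ⊗ₜ[A] KaehlerDifferential.D k A (μ b)) := rfl

/-- For `B` formally smooth, `b ↦ 1 ⊗ d (μ b)` modulo `I` lifts to a `B`-linear map on
`Ω_B`. -/
theorem exists_lift_kaehler {S' : Type} [CommRing S'] [Algebra k S']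
    [Algebra A S'] [Algebra B S'] [IsScalarTower A B S'] [IsScalarTower k A S']
    [IsScalarTower k B S'] [IsScalarTower k A B] [Algebra.FormallySmooth k B]
    (μ : B →ₐ[A] A) (I : Ideal B) (hI : ∀ b, μ b = 0 → b ∈ I) :
    ∃ π : Ω[B⁄k] →ₗ[B] S' ⊗[A] Ω[A⁄k], ∀ b,
      π (KaehlerDifferential.D k B b) - (1 : S') ⊗ₜ[A] KaehlerDifferential.D k A (μ b) ∈
        I • (⊤ : Submodule B (S' ⊗[A] Ω[A⁄k])) := by
  obtain ⟨π, hπ⟩ := Module.projective_lifting_property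
    (I • (⊤ : Submodule B (S' ⊗[A] Ω[A⁄k]))).mkQ
    (derivationModIdeal (k := k) (S' := S') μ I hI).liftKaehlerDifferential
    (Submodule.mkQ_surjective _)
  refine ⟨π, fun b => ?_⟩
  have h := LinearMap.congr_fun hπ (KaehlerDifferential.D k B b)
  rw [LinearMap.comp_apply, Derivation.liftKaehlerDifferential_comp_D,
    derivationModIdeal_apply, Submodule.mkQ_apply] at h
  exact (Submodule.Quotient.eq _).1 h

theorem mul_mem_smul_top_left {C : Type} [Ring C] [Algebra B C] (I : Ideal B) {x : C} (y : C)
    (hx : x ∈ I • (⊤ : Submodule B C)) : x * y ∈ I • (⊤ : Submodule B C) := by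
  refine Submodule.smul_induction_on hx (fun r hr n _ => ?_) fun u v hu hv => ?_
  · rw [smul_mul_assoc]; exact Submodule.smul_mem_smul hr trivial
  · rw [add_mul]; exact add_mem hu hv

theorem mul_mem_smul_top_right {C : Type} [Ring C] [Algebra B C] (I : Ideal B) {x : C} (y : C)
    (hx : x ∈ I • (⊤ : Submodule B C)) : y * x ∈ I • (⊤ : Submodule B C) := by
  refine Submodule.smul_induction_on hx (fun r hr n _ => ?_) fun u v hu hv => ?_
  · rw [mul_smul_comm]; exact Submodule.smul_mem_smul hr trivial
  · rw [mul_add]; exact add_mem hu hv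

theorem smul_eq_zero_of_mem_smul_top {C : Type} [AddCommGroup C] [Module B C] (I : Ideal B)
    (hC : ∀ r ∈ I, ∀ s ∈ I, ∀ c : C, (r * s) • c = 0) {r : B} (hr : r ∈ I) {x : C}
    (hx : x ∈ I • (⊤ : Submodule B C)) : r • x = 0 := by
  refine Submodule.smul_induction_on hx (fun s hs n _ => ?_) fun u v hu hv => ?_
  · rw [smul_smul, hC r hr s hs]
  · rw [smul_add, hu, hv, add_zero]

theorem mul_eq_zero_of_mem_smul_top {C : Type} [Ring C] [Algebra B C] (I : Ideal B)
    (hC : ∀ r ∈ I, ∀ s ∈ I, ∀ c : C, (r * s) • c = 0) {x y : C}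
    (hx : x ∈ I • (⊤ : Submodule B C)) (hy : y ∈ I • (⊤ : Submodule B C)) : x * y = 0 := by
  refine Submodule.smul_induction_on hx (fun r hr n _ => ?_) fun u v hu hv => ?_
  · rw [smul_mul_assoc]
    exact smul_eq_zero_of_mem_smul_top I hC hr (mul_mem_smul_top_right I n hy)
  · rw [add_mul, hu, hv, add_zero]

/-- An algebra map sending `dI` into `I·C` sends the differential ideal of `I` into `I·C`. -/
theorem map_Jdeg_mem {C : Type} [Ring C] [Algebra B C] (I : Ideal B)
    (P : ExteriorAlgebra B Ω[B⁄k] →ₐ[B] C)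
    (hP : ∀ θ ∈ I, P (dE k B θ) ∈ I • (⊤ : Submodule B C)) (n : ℕ)
    {x : ExteriorAlgebra B Ω[B⁄k]} (hx : x ∈ Jdeg k B I n) :
    P x ∈ I • (⊤ : Submodule B C) := by
  have h1 (m : ℕ) : I • OmegaPow k B m ≤ (I • (⊤ : Submodule B C)).comap P.toLinearMap := by
    refine Submodule.smul_le.2 fun r hr y _ => ?_
    rw [Submodule.mem_comap, map_smul]
    exact Submodule.smul_mem_smul hr trivial
  cases n with
  | zero => exact h1 0 hx
  | succ n =>
    have h2 : Jdeg k B I (n + 1) ≤ (I • (⊤ : Submodule B C)).comap P.toLinearMap := by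
      refine sup_le (h1 _) (Submodule.span_le.2 ?_)
      rintro _ ⟨θ, hθ, ε, -, rfl⟩
      rw [SetLike.mem_coe, Submodule.mem_comap, AlgHom.toLinearMap_apply, map_mul]
      exact mul_mem_smul_top_left I _ (hP θ hθ)
    exact h2 hx

theorem map_JJdeg_eq_zero {C : Type} [Ring C] [Algebra B C] (I : Ideal B)
    (hC : ∀ r ∈ I, ∀ s ∈ I, ∀ c : C, (r * s) • c = 0)
    (P : ExteriorAlgebra B Ω[B⁄k] →ₐ[B] C)
    (hP : ∀ θ ∈ I, P (dE k B θ) ∈ I • (⊤ : Submodule B C)) (j : ℕ) :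
    JJdeg k B I j ≤ LinearMap.ker P.toLinearMap := by
  refine iSup_le fun p => Submodule.span_le.2 ?_
  rintro _ ⟨y, hy, z, hz, rfl⟩
  rw [SetLike.mem_coe, LinearMap.mem_ker, AlgHom.toLinearMap_apply, map_mul]
  exact mul_eq_zero_of_mem_smul_top I hC (map_Jdeg_mem I P hP _ hy) (map_Jdeg_mem I P hP _ hz)

/-- For `B` formally smooth, there is a `B`-algebra map `Ω^•_B → S' ⊗ Ω^•_A` which modulo `I`
is the map induced by the retraction `μ`. -/
theorem exists_algHom_exterior {S' : Type} [CommRing S'] [Algebra k S']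
    [Algebra A S'] [Algebra B S'] [IsScalarTower A B S'] [IsScalarTower k A S']
    [IsScalarTower k B S'] [IsScalarTower k A B] [Algebra.FormallySmooth k B]
    (μ : B →ₐ[A] A) (I : Ideal B) (hI : ∀ b, μ b = 0 → b ∈ I) :
    ∃ P : ExteriorAlgebra B Ω[B⁄k] →ₐ[B] S' ⊗[A] ExteriorAlgebra A Ω[A⁄k], ∀ b,
      P (dE k B b) - (1 : S') ⊗ₜ[A] dE k A (μ b) ∈
        I • (⊤ : Submodule B (S' ⊗[A] ExteriorAlgebra A Ω[A⁄k])) := by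
  obtain ⟨π, hπ⟩ := exists_lift_kaehler (k := k) (S' := S') μ I hI
  let F : S' ⊗[A] Ω[A⁄k] →ₗ[B] S' ⊗[A] ExteriorAlgebra A Ω[A⁄k] :=
    ((ExteriorAlgebra.ι A).baseChange S').restrictScalars B
  have hF (m : Ω[B⁄k]) : (F ∘ₗ π) m * (F ∘ₗ π) m = 0 := baseChange_ι_mul_self (π m)
  refine ⟨ExteriorAlgebra.lift B ⟨F ∘ₗ π, hF⟩, fun b => ?_⟩
  have h : I • (⊤ : Submodule B (S' ⊗[A] Ω[A⁄k])) ≤ (I • (⊤ : Submodule B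
      (S' ⊗[A] ExteriorAlgebra A Ω[A⁄k]))).comap F := by
    refine Submodule.smul_le.2 fun r hr y _ => ?_
    rw [Submodule.mem_comap, map_smul]
    exact Submodule.smul_mem_smul hr trivial
  have h2 := h (hπ b)
  rw [Submodule.mem_comap, map_sub] at h2
  rw [dE, ExteriorAlgebra.lift_ι_apply]
  exact h2

/-- A lift as in `exists_algHom_exterior` sends the pullback of `δ` to `1 ⊗ δ` modulo `I`. -/
theorem algHom_pullback_sub_mem {S' : Type} [CommRing S']
    [Algebra A S'] [Algebra B S'] [IsScalarTower A B S']
    (μ : B →ₐ[A] A) (I : Ideal B)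
    (P : ExteriorAlgebra B Ω[B⁄k] →ₐ[B] S' ⊗[A] ExteriorAlgebra A Ω[A⁄k])
    (hP : ∀ b, P (dE k B b) - (1 : S') ⊗ₜ[A] dE k A (μ b) ∈
        I • (⊤ : Submodule B (S' ⊗[A] ExteriorAlgebra A Ω[A⁄k])))
    (p : ExteriorAlgebra A Ω[A⁄k] →+* ExteriorAlgebra B Ω[B⁄k])
    (hp : IsPullback k A B (algebraMap A B) p) (δ : ExteriorAlgebra A Ω[A⁄k]) :
    P (p δ) - (1 : S') ⊗ₜ[A] δ ∈
      I • (⊤ : Submodule B (S' ⊗[A] ExteriorAlgebra A Ω[A⁄k])) := by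
  have hscal (a : A) : P (p (algebraMap A _ a)) = (1 : S') ⊗ₜ[A] algebraMap A _ a := by
    rw [hp.1, AlgHom.commutes, ← IsScalarTower.algebraMap_apply A B,
      Algebra.TensorProduct.algebraMap_apply, Algebra.algebraMap_eq_smul_one,
      Algebra.algebraMap_eq_smul_one, TensorProduct.smul_tmul]
  have hmul (x y : ExteriorAlgebra A Ω[A⁄k])
      (hx : P (p x) - (1 : S') ⊗ₜ[A] x ∈
        I • (⊤ : Submodule B (S' ⊗[A] ExteriorAlgebra A Ω[A⁄k])))
      (hy : P (p y) - (1 : S') ⊗ₜ[A] y ∈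
        I • (⊤ : Submodule B (S' ⊗[A] ExteriorAlgebra A Ω[A⁄k]))) :
      P (p (x * y)) - (1 : S') ⊗ₜ[A] (x * y) ∈
        I • (⊤ : Submodule B (S' ⊗[A] ExteriorAlgebra A Ω[A⁄k])) := by
    have h : P (p (x * y)) - (1 : S') ⊗ₜ[A] (x * y) =
        (P (p x) - (1 : S') ⊗ₜ[A] x) * P (p y) +
          (1 : S') ⊗ₜ[A] x * (P (p y) - (1 : S') ⊗ₜ[A] y) := by
      rw [map_mul, map_mul, sub_mul, mul_sub, Algebra.TensorProduct.tmul_mul_tmul, one_mul]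
      abel
    rw [h]
    exact add_mem (mul_mem_smul_top_left I _ hx) (mul_mem_smul_top_right I _ hy)
  have hadd (x y : ExteriorAlgebra A Ω[A⁄k])
      (hx : P (p x) - (1 : S') ⊗ₜ[A] x ∈
        I • (⊤ : Submodule B (S' ⊗[A] ExteriorAlgebra A Ω[A⁄k])))
      (hy : P (p y) - (1 : S') ⊗ₜ[A] y ∈
        I • (⊤ : Submodule B (S' ⊗[A] ExteriorAlgebra A Ω[A⁄k]))) :
      P (p (x + y)) - (1 : S') ⊗ₜ[A] (x + y) ∈
        I • (⊤ : Submodule B (S' ⊗[A] ExteriorAlgebra A Ω[A⁄k])) := by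
    rw [map_add, map_add, TensorProduct.tmul_add, add_sub_add_comm]
    exact add_mem hx hy
  induction δ using ExteriorAlgebra.induction with
  | algebraMap a => rw [hscal, sub_self]; exact zero_mem _
  | mul x y hx hy => exact hmul x y hx hy
  | add x y hx hy => exact hadd x y hx hy
  | ι w =>
    have hw : w ∈ Submodule.span A (Set.range (KaehlerDifferential.D k A)) := by
      rw [KaehlerDifferential.span_range_derivation]; trivial
    induction hw using Submodule.span_induction with
    | mem x hx =>
      obtain ⟨a, rfl⟩ := hx
      have h := hP (algebraMap A B a)
      rw [AlgHom.commutes, Algebra.algebraMap_self_apply] at h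
      change P (p (dE k A a)) - (1 : S') ⊗ₜ[A] dE k A a ∈ _
      rw [hp.2]
      exact h
    | zero => simp
    | add x y _ _ hx hy => rw [map_add]; exact hadd _ _ hx hy
    | smul a x _ hx =>
      rw [map_smul, Algebra.smul_def]
      refine hmul _ _ ?_ hx
      rw [hscal, sub_self]; exact zero_mem _

/-- The `A`-linear projection `B → I / I²` attached to a retraction of `A → B` with
kernel `I`. -/
def toCotangentOfRetraction (μ : B →ₐ[A] A) (I : Ideal B) (hI : ∀ b, μ b = 0 ↔ b ∈ I) :
    B →ₗ[A] I.Cotangent :=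
  (I.toCotangent.restrictScalars A) ∘ₗ
    LinearMap.codRestrict (I.restrictScalars A)
      (LinearMap.id - Algebra.linearMap A B ∘ₗ μ.toLinearMap) fun b => (hI _).1 (by simp)

theorem toCotangentOfRetraction_coe (μ : B →ₐ[A] A) (I : Ideal B)
    (hI : ∀ b, μ b = 0 ↔ b ∈ I) (θ : I) :
    toCotangentOfRetraction μ I hI θ = I.toCotangent θ := by
  change I.toCotangent ⟨(θ : B) - algebraMap A B (μ θ), _⟩ = _
  congr 1
  ext
  simp [(hI _).2 θ.2]

/-- The `A`-linear projection `B / I² → I / I²` attached to a retraction of `A → B` with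
kernel `I`. -/
def cotangentProjection (μ : B →ₐ[A] A) (I : Ideal B) (hI : ∀ b, μ b = 0 ↔ b ∈ I) :
    (B ⧸ I ^ 2) →ₗ[A] I.Cotangent :=
  Submodule.liftQ ((I ^ 2).restrictScalars A) (toCotangentOfRetraction μ I hI) (fun b hb => by
    have hb' : b ∈ I ^ 2 := hb
    rw [LinearMap.mem_ker,
      toCotangentOfRetraction_coe μ I hI ⟨b, Ideal.pow_le_self two_ne_zero hb'⟩,
      Ideal.toCotangent_eq_zero]
    exact hb') ∘ₗ (Submodule.Quotient.restrictScalarsEquiv A (I ^ 2)).symm.toLinearMap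

theorem cotangentProjection_mk (μ : B →ₐ[A] A) (I : Ideal B) (hI : ∀ b, μ b = 0 ↔ b ∈ I)
    (θ : I) : cotangentProjection μ I hI (Ideal.Quotient.mk (I ^ 2) θ) = I.toCotangent θ :=
  toCotangentOfRetraction_coe μ I hI θ

/-- For `B` formally smooth and a retraction of `A → B` with kernel `I`, the class of
`θ • p δ` modulo `J·J` determines `θ̄ ⊗ δ`. -/
theorem exists_leftInverse [IsScalarTower k A B] [Algebra.FormallySmooth k B]
    (μ : B →ₐ[A] A) (I : Ideal B) (hI : ∀ b, μ b = 0 ↔ b ∈ I)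
    (p : ExteriorAlgebra A Ω[A⁄k] →+* ExteriorAlgebra B Ω[B⁄k])
    (hp : IsPullback k A B (algebraMap A B) p) (j : ℕ) :
    ∃ L : (ExteriorAlgebra B Ω[B⁄k] ⧸ JJdeg k B I j) →+
        I.Cotangent ⊗[A] ExteriorAlgebra A Ω[A⁄k],
      ∀ (θ : I) (δ : ExteriorAlgebra A Ω[A⁄k]),
        L ((JJdeg k B I j).mkQ ((θ : B) • p δ)) = I.toCotangent θ ⊗ₜ[A] δ := by
  obtain ⟨P, hP⟩ := exists_algHom_exterior (k := k) (S' := B ⧸ I ^ 2) μ I fun b => (hI b).1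
  have hC : ∀ r ∈ I, ∀ s ∈ I, ∀ c : (B ⧸ I ^ 2) ⊗[A] ExteriorAlgebra A Ω[A⁄k],
      (r * s) • c = 0 := by
    intro r hr s hs c
    have hrs : r * s ∈ I ^ 2 := by rw [pow_two]; exact Ideal.mul_mem_mul hr hs
    have h0 : algebraMap B (B ⧸ I ^ 2) (r * s) = 0 := Ideal.Quotient.eq_zero_iff_mem.2 hrs
    rw [← algebraMap_smul (B ⧸ I ^ 2) (r * s) c, h0, zero_smul]
  have hPI : ∀ θ ∈ I, P (dE k B θ) ∈
      I • (⊤ : Submodule B ((B ⧸ I ^ 2) ⊗[A] ExteriorAlgebra A Ω[A⁄k])) := by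
    intro θ hθ
    have h := hP θ
    rwa [(hI θ).2 hθ, dE, dE, map_zero, map_zero, TensorProduct.tmul_zero, sub_zero] at h
  refine ⟨((cotangentProjection μ I hI).rTensor
      (ExteriorAlgebra A Ω[A⁄k])).toAddMonoidHom.comp
    ((JJdeg k B I j).liftQ P.toLinearMap (map_JJdeg_eq_zero I hC P hPI j)).toAddMonoidHom,
    fun θ δ => ?_⟩
  change (cotangentProjection μ I hI).rTensor _ (P ((θ : B) • p δ)) = _
  have h := smul_eq_zero_of_mem_smul_top I hC θ.2 (algHom_pullback_sub_mem μ I P hP p hp δ)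
  rw [smul_sub, sub_eq_zero] at h
  rw [map_smul, h, TensorProduct.smul_tmul', LinearMap.rTensor_tmul,
    ← cotangentProjection_mk μ I hI]
  congr 2
  rw [Algebra.smul_def, mul_one]
  rfl

theorem smul_mem_JJdeg (I : Ideal B) {j : ℕ} {θ : B} (hθ : θ ∈ I)
    {x : ExteriorAlgebra B Ω[B⁄k]} (hx : x ∈ Jdeg k B I j) : θ • x ∈ JJdeg k B I j := by
  refine Submodule.mem_iSup_of_mem ⟨(0, j), zero_add j⟩ (Submodule.subset_span ?_)
  refine ⟨θ • 1, Submodule.smul_mem_smul hθ ?_, x, hx, ?_⟩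
  · rw [OmegaPow, pow_zero]; exact Submodule.one_le.1 le_rfl
  · rw [smul_mul_assoc, one_mul]

theorem smul_mem_Jdeg (I : Ideal B) {j : ℕ} {θ : B} (hθ : θ ∈ I)
    {x : ExteriorAlgebra B Ω[B⁄k]} (hx : x ∈ OmegaPow k B j) : θ • x ∈ Jdeg k B I j := by
  cases j with
  | zero => exact Submodule.smul_mem_smul hθ hx
  | succ j => exact Submodule.mem_sup_left (Submodule.smul_mem_smul hθ hx)

theorem dE_mul_mem_OmegaPow (b : B) {j : ℕ} {x : ExteriorAlgebra B Ω[B⁄k]}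
    (hx : x ∈ OmegaPow k B j) : dE k B b * x ∈ OmegaPow k B (j + 1) := by
  rw [OmegaPow, pow_succ']
  exact Submodule.mul_mem_mul ⟨_, rfl⟩ hx

theorem dE_mul_mem_Jdeg (I : Ideal B) (b : B) {j : ℕ} {x : ExteriorAlgebra B Ω[B⁄k]}
    (hx : x ∈ Jdeg k B I j) : dE k B b * x ∈ Jdeg k B I (j + 1) := by
  have h1 : I • OmegaPow k B j ≤
      (Jdeg k B I (j + 1)).comap (LinearMap.mulLeft B (dE k B b)) := by
    refine Submodule.smul_le.2 fun r hr y hy => ?_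
    rw [Submodule.mem_comap, LinearMap.mulLeft_apply, mul_smul_comm]
    exact smul_mem_Jdeg I hr (dE_mul_mem_OmegaPow b hy)
  cases j with
  | zero => exact h1 hx
  | succ j =>
    have h2 : Jdeg k B I (j + 1) ≤
        (Jdeg k B I (j + 1 + 1)).comap (LinearMap.mulLeft B (dE k B b)) := by
      refine sup_le h1 (Submodule.span_le.2 ?_)
      rintro _ ⟨θ, hθ, ε, hε, rfl⟩
      have hswap : dE k B b * dE k B θ = -(dE k B θ * dE k B b) :=
        eq_neg_of_add_eq_zero_left (ExteriorAlgebra.ι_add_mul_swap _ _)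
      rw [SetLike.mem_coe, Submodule.mem_comap, LinearMap.mulLeft_apply, ← mul_assoc, hswap,
        neg_mul, mul_assoc]
      exact neg_mem (Submodule.mem_sup_right (Submodule.subset_span
        ⟨θ, hθ, _, dE_mul_mem_OmegaPow b hε, rfl⟩))
    exact h2 hx

theorem OmegaPow_succ_le {j : ℕ} {N : Submodule B (ExteriorAlgebra B Ω[B⁄k])}
    (h : ∀ b, ∀ x ∈ OmegaPow k B j, dE k B b * x ∈ N) : OmegaPow k B (j + 1) ≤ N := by
  rw [OmegaPow, pow_succ']
  refine Submodule.mul_le.2 ?_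
  rintro _ ⟨w, rfl⟩ x hx
  have hw : w ∈ Submodule.span B (Set.range (KaehlerDifferential.D k B)) := by
    rw [KaehlerDifferential.span_range_derivation]; trivial
  induction hw using Submodule.span_induction with
  | mem y hy => obtain ⟨b, rfl⟩ := hy; exact h b x hx
  | zero => rw [map_zero, zero_mul]; exact zero_mem _
  | add y z _ _ hy hz => rw [map_add, add_mul]; exact add_mem hy hz
  | smul b y _ hy => rw [map_smul, smul_mul_assoc]; exact N.smul_mem b hy

theorem pullback_smul (p : ExteriorAlgebra A Ω[A⁄k] →+* ExteriorAlgebra B Ω[B⁄k])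
    (hp : IsPullback k A B (algebraMap A B) p) (a : A) (δ : ExteriorAlgebra A Ω[A⁄k]) :
    p (a • δ) = algebraMap A B a • p δ := by
  rw [Algebra.smul_def, map_mul, hp.1, ← Algebra.smul_def]

theorem pullback_mem_OmegaPow (p : ExteriorAlgebra A Ω[A⁄k] →+* ExteriorAlgebra B Ω[B⁄k])
    (hp : IsPullback k A B (algebraMap A B) p) (j : ℕ) {δ : ExteriorAlgebra A Ω[A⁄k]}
    (hδ : δ ∈ OmegaPow k A j) : p δ ∈ OmegaPow k B j := by
  let N (n : ℕ) : Submodule A (ExteriorAlgebra A Ω[A⁄k]) :=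
    { carrier := {x | p x ∈ OmegaPow k B n}
      add_mem' := fun {x y} hx hy => by
        rw [Set.mem_ofPred_eq, map_add]; exact add_mem hx hy
      zero_mem' := by rw [Set.mem_ofPred_eq, map_zero]; exact zero_mem _
      smul_mem' := fun a x hx => by
        rw [Set.mem_ofPred_eq, pullback_smul p hp]; exact Submodule.smul_mem _ _ hx }
  suffices h : OmegaPow k A j ≤ N j from h hδ
  clear hδ
  induction j with
  | zero =>
    rw [OmegaPow, pow_zero, Submodule.one_le]
    change p 1 ∈ OmegaPow k B 0
    rw [map_one, OmegaPow, pow_zero]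
    exact Submodule.one_le.1 le_rfl
  | succ j ih =>
    refine OmegaPow_succ_le fun a x hx => ?_
    change p (dE k A a * x) ∈ OmegaPow k B (j + 1)
    rw [map_mul, hp.2]
    exact dE_mul_mem_OmegaPow _ (ih hx)

/-- Forms on `B` are generated modulo `J` by pullbacks of forms on the retract `A`. -/
theorem OmegaPow_le_span_pullback_sup_Jdeg
    (μ : B →ₐ[A] A) (I : Ideal B) (hI : ∀ b, μ b = 0 → b ∈ I)
    (p : ExteriorAlgebra A Ω[A⁄k] →+* ExteriorAlgebra B Ω[B⁄k])
    (hp : IsPullback k A B (algebraMap A B) p) (j : ℕ) :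
    OmegaPow k B j ≤ Submodule.span B (p '' OmegaPow k A j) ⊔ Jdeg k B I j := by
  induction j with
  | zero =>
    rw [OmegaPow, pow_zero, Submodule.one_le]
    refine Submodule.mem_sup_left (Submodule.subset_span ⟨1, ?_, map_one p⟩)
    rw [OmegaPow, pow_zero]
    exact Submodule.one_le.1 le_rfl
  | succ j ih =>
    refine OmegaPow_succ_le fun b x hx => ?_
    have hb : dE k B b = p (dE k A (μ b)) + dE k B (b - algebraMap A B (μ b)) := by
      rw [hp.2, dE, dE, dE, ← map_add, ← map_add, add_sub_cancel]
    rw [hb, add_mul]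
    refine add_mem ?_ (Submodule.mem_sup_right (Submodule.mem_sup_right
      (Submodule.subset_span ⟨_, hI _ (by simp), x, hx, rfl⟩)))
    have h : Submodule.span B (p '' OmegaPow k A j) ⊔ Jdeg k B I j ≤
        (Submodule.span B (p '' OmegaPow k A (j + 1)) ⊔ Jdeg k B I (j + 1)).comap
          (LinearMap.mulLeft B (p (dE k A (μ b)))) := by
      refine sup_le (Submodule.span_le.2 ?_) fun y hy => ?_
      · rintro _ ⟨δ, hδ, rfl⟩
        rw [SetLike.mem_coe, Submodule.mem_comap, LinearMap.mulLeft_apply, ← map_mul]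
        exact Submodule.mem_sup_left (Submodule.subset_span
          ⟨_, dE_mul_mem_OmegaPow (μ b) hδ, rfl⟩)
      · rw [Submodule.mem_comap, LinearMap.mulLeft_apply, hp.2]
        exact Submodule.mem_sup_right (dE_mul_mem_Jdeg I _ hy)
    exact h (ih hx)

/-- The biadditive map `(θ, δ) ↦ θ • p δ` modulo `J·J`, as a map on the conormal module. -/
def conormalPairing (I : Ideal B)
    (p : ExteriorAlgebra A Ω[A⁄k] →+* ExteriorAlgebra B Ω[B⁄k])
    (hp : IsPullback k A B (algebraMap A B) p) (j : ℕ) :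
    I.Cotangent →ₗ[B] OmegaPow k A j →+ (ExteriorAlgebra B Ω[B⁄k] ⧸ JJdeg k B I j) :=
  Ideal.Cotangent.lift
    { toFun := fun θ => (((LinearMap.toSpanSingleton B
          (Module.End B (ExteriorAlgebra B Ω[B⁄k] ⧸ JJdeg k B I j)) 1 θ).comp
          (JJdeg k B I j).mkQ).toAddMonoidHom.comp p.toAddMonoidHom).comp
          (OmegaPow k A j).subtype.toAddMonoidHom
      map_add' := fun θ η => by
        ext δ
        exact add_smul (θ : B) (η : B) ((JJdeg k B I j).mkQ (p δ))
      map_smul' := fun b θ => by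
        ext δ
        exact mul_smul b (θ : B) ((JJdeg k B I j).mkQ (p δ)) }
    (fun θ η => by
      ext δ
      change ((θ : B) * (η : B)) • (JJdeg k B I j).mkQ (p δ) = 0
      rw [← map_smul, Submodule.mkQ_apply, Submodule.Quotient.mk_eq_zero, mul_smul]
      exact smul_mem_JJdeg I θ.2 (smul_mem_Jdeg I η.2 (pullback_mem_OmegaPow p hp j δ.2)))

theorem conormalPairing_toCotangent (I : Ideal B)
    (p : ExteriorAlgebra A Ω[A⁄k] →+* ExteriorAlgebra B Ω[B⁄k])
    (hp : IsPullback k A B (algebraMap A B) p) (j : ℕ) (θ : I) (δ : OmegaPow k A j) :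
    conormalPairing I p hp j (I.toCotangent θ) δ = (JJdeg k B I j).mkQ ((θ : B) • p δ) := by
  rw [conormalPairing, Ideal.Cotangent.lift_toCotangent, map_smul]
  rfl

/-- The map `θ̄ ⊗ δ ↦ θ • p δ` modulo `J·J`. -/
def conormalMap (I : Ideal B)
    (p : ExteriorAlgebra A Ω[A⁄k] →+* ExteriorAlgebra B Ω[B⁄k])
    (hp : IsPullback k A B (algebraMap A B) p) (j : ℕ) :
    I.Cotangent ⊗[A] OmegaPow k A j →+ (ExteriorAlgebra B Ω[B⁄k] ⧸ JJdeg k B I j) :=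
  TensorProduct.liftAddHom (conormalPairing I p hp j).toAddMonoidHom (by
    intro a m δ
    obtain ⟨θ, rfl⟩ := I.toCotangent_surjective m
    change conormalPairing I p hp j _ _ = conormalPairing I p hp j _ _
    rw [← algebraMap_smul B a (I.toCotangent θ), ← map_smul, conormalPairing_toCotangent,
      conormalPairing_toCotangent, Submodule.coe_smul, Submodule.coe_smul, pullback_smul p hp,
      smul_smul, smul_eq_mul, mul_comm])

theorem conormalMap_tmul (I : Ideal B)
    (p : ExteriorAlgebra A Ω[A⁄k] →+* ExteriorAlgebra B Ω[B⁄k])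
    (hp : IsPullback k A B (algebraMap A B) p) (j : ℕ) (θ : I) (δ : OmegaPow k A j) :
    conormalMap I p hp j (I.toCotangent θ ⊗ₜ[A] δ) =
      (JJdeg k B I j).mkQ ((θ : B) • p δ) :=
  conormalPairing_toCotangent I p hp j θ δ

theorem conormalMap_smul (I : Ideal B)
    (p : ExteriorAlgebra A Ω[A⁄k] →+* ExteriorAlgebra B Ω[B⁄k])
    (hp : IsPullback k A B (algebraMap A B) p) (j : ℕ) (a : A)
    (m : I.Cotangent ⊗[A] OmegaPow k A j) :
    conormalMap I p hp j (a • m) = algebraMap A B a • conormalMap I p hp j m := by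
  induction m with
  | zero => simp
  | add x y hx hy => rw [smul_add, map_add, map_add, smul_add, hx, hy]
  | tmul m δ =>
    obtain ⟨θ, rfl⟩ := I.toCotangent_surjective m
    rw [TensorProduct.smul_tmul', ← algebraMap_smul B a (I.toCotangent θ), ← map_smul,
      conormalMap_tmul, conormalMap_tmul, ← map_smul (JJdeg k B I j).mkQ, Submodule.coe_smul,
      smul_smul, smul_eq_mul]

theorem conormalMap_injective [IsScalarTower k A B] [Algebra.FormallySmooth k B]
    (μ : B →ₐ[A] A) (I : Ideal B) (hI : ∀ b, μ b = 0 ↔ b ∈ I) [Module.Flat A I.Cotangent]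
    (p : ExteriorAlgebra A Ω[A⁄k] →+* ExteriorAlgebra B Ω[B⁄k])
    (hp : IsPullback k A B (algebraMap A B) p) (j : ℕ) :
    Function.Injective (conormalMap I p hp j) := by
  obtain ⟨L, hL⟩ := exists_leftInverse μ I hI p hp j
  have h (m : I.Cotangent ⊗[A] OmegaPow k A j) : L (conormalMap I p hp j m) =
      (OmegaPow k A j).subtype.lTensor I.Cotangent m := by
    induction m with
    | zero => simp
    | add x y hx hy => rw [map_add, map_add, map_add, hx, hy]
    | tmul m δ =>
      obtain ⟨θ, rfl⟩ := I.toCotangent_surjective m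
      rw [conormalMap_tmul, hL]
      rfl
  intro m n hmn
  apply Module.Flat.lTensor_preserves_injective_linearMap (M := I.Cotangent) _
    (OmegaPow k A j).injective_subtype
  rw [← h, ← h, hmn]

theorem range_conormalMap (μ : B →ₐ[A] A) (I : Ideal B) (hI : ∀ b, μ b = 0 → b ∈ I)
    (p : ExteriorAlgebra A Ω[A⁄k] →+* ExteriorAlgebra B Ω[B⁄k])
    (hp : IsPullback k A B (algebraMap A B) p) (j : ℕ) :
    Set.range (conormalMap I p hp j) =
      ↑((I • OmegaPow k B j).map (JJdeg k B I j).mkQ) := by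
  apply Set.Subset.antisymm
  · rintro _ ⟨m, rfl⟩
    rw [SetLike.mem_coe]
    induction m with
    | zero => rw [map_zero]; exact zero_mem _
    | add x y hx hy => rw [map_add]; exact add_mem hx hy
    | tmul m δ =>
      obtain ⟨θ, rfl⟩ := I.toCotangent_surjective m
      rw [conormalMap_tmul]
      exact Submodule.mem_map_of_mem
        (Submodule.smul_mem_smul θ.2 (pullback_mem_OmegaPow p hp j δ.2))
  · have hle : ∀ x ∈ Submodule.span B (p '' OmegaPow k A j), ∀ θ ∈ I,
        (JJdeg k B I j).mkQ (θ • x) ∈ (conormalMap I p hp j).range := by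
      intro x hx
      induction hx using Submodule.span_induction with
      | mem x hx =>
        obtain ⟨δ, hδ, rfl⟩ := hx
        exact fun θ hθ => ⟨I.toCotangent ⟨θ, hθ⟩ ⊗ₜ ⟨δ, hδ⟩, conormalMap_tmul _ _ _ _ _ _⟩
      | zero => intro θ _; rw [smul_zero, map_zero]; exact zero_mem _
      | add x y _ _ hx hy =>
        intro θ hθ; rw [smul_add, map_add]; exact add_mem (hx θ hθ) (hy θ hθ)
      | smul b x _ hx =>
        intro θ hθ; rw [smul_smul]; exact hx _ (I.mul_mem_right b hθ)
    rintro _ ⟨x, hx, rfl⟩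
    change _ ∈ (conormalMap I p hp j).range
    rw [SetLike.mem_coe] at hx
    refine Submodule.smul_induction_on hx (fun θ hθ x hx => ?_) fun x y hx hy => ?_
    · obtain ⟨y, hy, z, hz, rfl⟩ := Submodule.mem_sup.1
        (OmegaPow_le_span_pullback_sup_Jdeg μ I hI p hp j hx)
      have hz0 : (JJdeg k B I j).mkQ (θ • z) = 0 :=
        (Submodule.Quotient.mk_eq_zero _).2 (smul_mem_JJdeg I hθ hz)
      rw [smul_add, map_add, hz0, add_zero]
      exact hle y hy θ hθ
    · rw [map_add]; exact add_mem hx hy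

end Retraction

/-!
STATEMENT 2.
Let `k` be a field, `A` a smooth `k`-algebra (of finite presentation and formally smooth),
and `j ≥ 1`.  The assignment `θ̄ ⊗ δ ↦ class of θ·p₁^*(δ)` defines an isomorphism of
`A`-modules `I/I² ⊗_A Ω^j_A ≅ (I·Ω^j_{A⊗A} + (J·J)^j)/(J·J)^j`, i.e. onto the image of
`I·Ω^j_{A⊗A}` in `Ω^j_{A⊗A}/(J·J)^j`.

Formalization notes: `I/I²` with its `A`-module structure is by definition
`KaehlerDifferential k A` and `θ ↦ θ̄` is `KaehlerDifferential.fromIdeal`; the assignment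
is realized as an additive map `a` into `Ω^•_{A⊗A}/(J·J)^j` which is `A`-linear (via the
action of `x ⊗ 1`); the isomorphism claim says `a` is injective with range exactly the
image of `I • Ω^j_{A⊗A}` under the quotient map.  `p₁^*` is the map induced on forms by
`a ↦ a⊗1`, characterized by `IsPullback`.
-/
theorem stmt2 (A : Type) [CommRing A] [Algebra k A]
    [Algebra.FormallySmooth k A] [Algebra.FinitePresentation k A]
    (j : ℕ) (hj : 1 ≤ j)
    (p1 : ExteriorAlgebra A (KaehlerDifferential k A) →+*
      ExteriorAlgebra (A ⊗[k] A) (KaehlerDifferential k (A ⊗[k] A)))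
    (hp1 : IsPullback k A (A ⊗[k] A)
      (Algebra.TensorProduct.includeLeftRingHom : A →+* A ⊗[k] A) p1) :
    ∃ a : (KaehlerDifferential k A ⊗[A] ↥(OmegaPow k A j)) →+
        (ExteriorAlgebra (A ⊗[k] A) (KaehlerDifferential k (A ⊗[k] A)) ⧸
          JJdeg k (A ⊗[k] A) (KaehlerDifferential.ideal k A) j),
      -- defining property: `a(θ̄ ⊗ δ)` is the class of `θ·p₁^*(δ)`
      (∀ (θ : A ⊗[k] A) (hθ : θ ∈ KaehlerDifferential.ideal k A)
          (δ : ExteriorAlgebra A (KaehlerDifferential k A)) (hδ : δ ∈ OmegaPow k A j),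
        a ((KaehlerDifferential.fromIdeal k A ⟨θ, hθ⟩) ⊗ₜ[A]
            (⟨δ, hδ⟩ : ↥(OmegaPow k A j))) =
          (JJdeg k (A ⊗[k] A) (KaehlerDifferential.ideal k A) j).mkQ (θ • p1 δ)) ∧
      -- `A`-linearity
      (∀ (x : A) (m : KaehlerDifferential k A ⊗[A] ↥(OmegaPow k A j)),
        a (x • m) = ((x ⊗ₜ[k] (1 : A)) : A ⊗[k] A) • a m) ∧
      -- isomorphism onto the image of `I·Ω^j_{A⊗A}` in `Ω^j_{A⊗A}/(J·J)^j`
      Function.Injective a ∧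
      Set.range a =
        ↑(((KaehlerDifferential.ideal k A) • OmegaPow k (A ⊗[k] A) j).map
          (JJdeg k (A ⊗[k] A) (KaehlerDifferential.ideal k A) j).mkQ) := by
  have : Algebra.FormallySmooth k (A ⊗[k] A) := .comp k A (A ⊗[k] A)
  have hI (b : A ⊗[k] A) : Algebra.TensorProduct.lmul'' k b = 0 ↔
      b ∈ KaehlerDifferential.ideal k A := Iff.rfl
  have : Module.Flat A (KaehlerDifferential.ideal k A).Cotangent :=
    inferInstanceAs (Module.Flat A (KaehlerDifferential k A))
  exact ⟨conormalMap _ p1 hp1 j, fun θ hθ δ hδ => conormalMap_tmul _ p1 hp1 j ⟨θ, hθ⟩ ⟨δ, hδ⟩,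
    conormalMap_smul _ p1 hp1 j,
    conormalMap_injective _ _ hI p1 hp1 j,
    range_conormalMap _ _ (fun b => (hI b).1) p1 hp1 j⟩

end
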